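/- (Phase-mixing bound for Gaussian moments.) Let N ∈ ℕ. There exists a constant C_N > 0 such that for every Schwartz function h : ℝ³ → ℂ and every ζ ∈ ℝ³, (1 + |ζ|^N) · | ∫_{ℝ³} h(v) μ(v)^{1/2} dv | ≤ C_N Σ_{|ω| ≤ N} ‖ (∇_v + iζ)^ω h ‖_{L²(ℝ³)}, where for a multi-index ω the operator (∇_v + iζ)^ω is the composition Π_{j=1}^3 (∂_{v_j} + i ζ_j)^{ω_j}. -/

import Mathlib

open MeasureTheory Real

noncomputable section

/-- ℝ³ as a Euclidean space. -/
abbrev E3 := EuclideanSpace ℝ (Fin 3)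

/-- Multi-indices `ω ∈ ℕ³` with `|ω| = ω₁ + ω₂ + ω₃ ≤ N`. -/
def multiIdx (N : ℕ) : Finset (Fin 3 → ℕ) :=
  (Fintype.piFinset fun _ : Fin 3 => Finset.range (N + 1)).filter fun ω => ∑ j, ω j ≤ N

/-- The operator `∂_{v_j} + i ζ_j` acting on functions `ℝ³ → ℂ`. -/
def Yop (ζ : E3) (j : Fin 3) (g : E3 → ℂ) : E3 → ℂ := fun v =>
  fderiv ℝ g v (EuclideanSpace.single j 1) + Complex.I * (ζ j : ℂ) * g v

/-- The composition `(∇_v + iζ)^ω = Π_j (∂_{v_j} + i ζ_j)^{ω_j}`. -/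
def Yiter (ζ : E3) (ω : Fin 3 → ℕ) (g : E3 → ℂ) : E3 → ℂ :=
  (Yop ζ 0)^[ω 0] <| (Yop ζ 1)^[ω 1] <| (Yop ζ 2)^[ω 2] g

/-- The `L²(ℝ³)` norm of a complex-valued function. -/
def l2norm (g : E3 → ℂ) : ℝ := Real.sqrt (∫ v : E3, ‖g v‖ ^ 2)

/-- The normalized global Maxwellian `μ(v) = (2π)^{−3/2} e^{−|v|²/2}`. -/
def maxwellian (v : E3) : ℝ := (2 * Real.pi) ^ (-(3:ℝ)/2) * Real.exp (-‖v‖ ^ 2 / 2)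

open scoped SchwartzMap LineDeriv

theorem pm_poly_exp_bound (M : ℕ) (r : ℝ) (hr : 0 ≤ r) :
    (1 + r) ^ M * Real.exp (-(r ^ 2) / 4) ≤ M.factorial * Real.exp 2 := by
  have h1 : (1 + r) ^ M ≤ M.factorial * Real.exp (1 + r) := by
    have h := Real.pow_div_factorial_le_exp (1 + r) (by linarith) M
    rw [div_le_iff₀ (by positivity)] at h
    linarith
  calc (1 + r) ^ M * Real.exp (-(r ^ 2) / 4)
      ≤ (M.factorial * Real.exp (1 + r)) * Real.exp (-(r ^ 2) / 4) := by gcongr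
    _ = M.factorial * Real.exp (1 + r + -(r ^ 2) / 4) := by rw [Real.exp_add (1 + r)]; ring
    _ ≤ M.factorial * Real.exp 2 := by
        gcongr
        nlinarith [sq_nonneg (r - 2)]

theorem pm_temperate : (fun v : E3 => -(‖v‖ ^ 2) / 4).HasTemperateGrowth := by
  have h := (Function.HasTemperateGrowth.const (E := E3) (-1 / 4 : ℝ)).mul
    (Function.hasTemperateGrowth_norm_sq (H := E3))
  have e : (fun v : E3 => -(‖v‖ ^ 2) / 4) = (fun _ : E3 => (-1 / 4 : ℝ)) * fun v : E3 => ‖v‖ ^ 2 := by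
    funext v
    simp only [Pi.mul_apply]
    ring
  rw [e]
  exact h

theorem pm_gauss_decay (k n : ℕ) : ∃ C : ℝ, ∀ x : E3,
    ‖x‖ ^ k * ‖iteratedFDeriv ℝ n (fun v : E3 => Real.exp (-(‖v‖ ^ 2) / 4)) x‖ ≤ C := by
  obtain ⟨m, K, hK, hb⟩ := pm_temperate.norm_iteratedFDeriv_le_uniform n
  refine ⟨n.factorial * (K + 1) ^ n * ((k + m * n).factorial * Real.exp 2), fun x => ?_⟩
  have hx : (1 : ℝ) ≤ 1 + ‖x‖ := by linarith [norm_nonneg x]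
  have h := norm_iteratedFDeriv_comp_le (𝕜 := ℝ) (n := n) (N := ((⊤ : ℕ∞) : WithTop ℕ∞)) (g := Real.exp)
    (f := fun v : E3 => -(‖v‖ ^ 2) / 4) Real.contDiff_exp pm_temperate.1
    (by exact_mod_cast le_top) x
    (C := Real.exp (-(‖x‖ ^ 2) / 4)) (D := (K + 1) * (1 + ‖x‖) ^ m)
    (fun i _ => by
      rw [norm_iteratedFDeriv_eq_norm_iteratedDeriv, iteratedDeriv_eq_iterate,
        Real.iter_deriv_exp, Real.norm_of_nonneg (Real.exp_pos _).le])
    (fun i hi hin => by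
      refine (hb i hin x).trans ?_
      have h1 : (1 : ℝ) ≤ (1 + ‖x‖) ^ m := one_le_pow₀ hx
      have h2 : (1 : ℝ) ≤ (K + 1) * (1 + ‖x‖) ^ m := by nlinarith
      calc K * (1 + ‖x‖) ^ m ≤ (K + 1) * (1 + ‖x‖) ^ m := by gcongr; linarith
        _ ≤ _ := le_self_pow₀ h2 (by omega))
  calc _ ≤ (1 + ‖x‖) ^ k * (n.factorial * Real.exp (-(‖x‖ ^ 2) / 4)
        * ((K + 1) * (1 + ‖x‖) ^ m) ^ n) := by
        gcongr
        · linarith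
        · exact h
    _ = n.factorial * (K + 1) ^ n * ((1 + ‖x‖) ^ (k + m * n) * Real.exp (-(‖x‖ ^ 2) / 4)) := by
        rw [mul_pow, pow_add, pow_mul]; ring
    _ ≤ _ := by
        exact mul_le_mul_of_nonneg_left (pm_poly_exp_bound _ _ (norm_nonneg x)) (by positivity)

/-- The Gaussian as a real Schwartz function. -/
def pmGaussR : SchwartzMap E3 ℝ where
  toFun := fun v => Real.exp (-(‖v‖ ^ 2) / 4)
  smooth' := Real.contDiff_exp.comp pm_temperate.1
  decay' := pm_gauss_decay

/-- The square root of the Maxwellian as a complex Schwartz function. -/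
def pmGauss : SchwartzMap E3 ℂ :=
  (Real.sqrt ((2 * Real.pi) ^ (-(3:ℝ)/2))) • pmGaussR.postcompCLM Complex.ofRealCLM

theorem pmGauss_apply (v : E3) : pmGauss v = ((Real.sqrt (maxwellian v) : ℝ) : ℂ) := by
  have h1 : Real.sqrt (maxwellian v) =
      Real.sqrt ((2 * Real.pi) ^ (-(3:ℝ)/2)) * Real.exp (-(‖v‖ ^ 2) / 4) := by
    unfold maxwellian
    rw [Real.sqrt_mul (by positivity), Real.sqrt_eq_rpow (Real.exp _), ← Real.exp_mul]
    congr 2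
    ring
  have h2 : pmGaussR v = Real.exp (-(‖v‖ ^ 2) / 4) := rfl
  rw [h1, pmGauss, smul_apply, SchwartzMap.postcompCLM_apply, h2]
  simp

/-- The twisted derivative on Schwartz space. -/
def pmY (ζ : E3) (j : Fin 3) (h : SchwartzMap E3 ℂ) : SchwartzMap E3 ℂ :=
  ∂_{(EuclideanSpace.single j (1:ℝ) : E3)} h + (Complex.I * (ζ j : ℂ)) • h

theorem pmY_coe (ζ : E3) (j : Fin 3) (h : SchwartzMap E3 ℂ) :
    (pmY ζ j h : E3 → ℂ) = Yop ζ j h := by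
  funext v
  simp [pmY, Yop, SchwartzMap.lineDerivOp_apply_eq_fderiv]

theorem pm_l2_nonneg (g : E3 → ℂ) : 0 ≤ l2norm g := Real.sqrt_nonneg _

theorem pm_cs (h G : SchwartzMap E3 ℂ) : ‖∫ v, h v * G v‖ ≤ l2norm G * l2norm h := by
  have hc := integral_mul_norm_le_Lp_mul_Lq (μ := (volume : Measure E3)) (f := h) (g := G)
    Real.HolderConjugate.two_two (h.memLp _) (G.memLp _)
  refine (norm_integral_le_integral_norm _).trans ?_
  simp only [norm_mul]
  refine hc.trans (le_of_eq ?_)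
  simp only [l2norm, Real.sqrt_eq_rpow, Real.rpow_two]
  ring

theorem pm_integrable (h G : SchwartzMap E3 ℂ) : Integrable (fun v => h v * G v) :=
  (h.memLp 2).integrable_mul (G.memLp 2)

theorem pm_ibp (ζ : E3) (j : Fin 3) (h G : SchwartzMap E3 ℂ) :
    (Complex.I * (ζ j : ℂ)) * ∫ v, h v * G v =
      (∫ v, pmY ζ j h v * G v) +
        ∫ v, h v * (∂_{(EuclideanSpace.single j (1:ℝ) : E3)} G) v := by
  rw [SchwartzMap.integral_mul_lineDerivOp_right_eq_neg_left]
  have : (∫ v, pmY ζ j h v * G v) =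
      (∫ v, (∂_{(EuclideanSpace.single j (1:ℝ) : E3)} h) v * G v) +
        (Complex.I * (ζ j : ℂ)) * ∫ v, h v * G v := by
    rw [← integral_const_mul, ← integral_add (pm_integrable _ _)
      ((pm_integrable _ _).const_mul _)]
    congr 1
    funext v
    simp [pmY]
    ring
  rw [this]
  ring

theorem pm_main (j : Fin 3) (N : ℕ) : ∀ G : SchwartzMap E3 ℂ, ∃ C : ℝ, 0 ≤ C ∧
    ∀ (h : SchwartzMap E3 ℂ) (ζ : E3), |ζ j| ^ N * ‖∫ v, h v * G v‖ ≤
      C * ∑ k ∈ Finset.range (N + 1), l2norm ((Yop ζ j)^[k] h) := by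
  induction N with
  | zero =>
    intro G
    refine ⟨l2norm G, pm_l2_nonneg _, fun h ζ => ?_⟩
    simpa using pm_cs h G
  | succ N ih =>
    intro G
    obtain ⟨C1, hC1, h1⟩ := ih G
    obtain ⟨C2, hC2, h2⟩ := ih (∂_{(EuclideanSpace.single j (1:ℝ) : E3)} G)
    refine ⟨C1 + C2, by positivity, fun h ζ => ?_⟩
    have e1 := h1 (pmY ζ j h) ζ
    have e2 := h2 h ζ
    have e3 := congrArg norm (pm_ibp ζ j h G)
    rw [norm_mul, norm_mul, Complex.norm_I, one_mul, Complex.norm_real, Real.norm_eq_abs] at e3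
    have s1 : ∑ k ∈ Finset.range (N + 1), l2norm ((Yop ζ j)^[k] (pmY ζ j h)) ≤
        ∑ k ∈ Finset.range (N + 1 + 1), l2norm ((Yop ζ j)^[k] h) := by
      rw [Finset.sum_range_succ' _ (N + 1), pmY_coe]
      simp only [Function.iterate_succ_apply]
      linarith [pm_l2_nonneg ((Yop ζ j)^[0] h)]
    have s2 : ∑ k ∈ Finset.range (N + 1), l2norm ((Yop ζ j)^[k] h) ≤
        ∑ k ∈ Finset.range (N + 1 + 1), l2norm ((Yop ζ j)^[k] h) := by
      rw [Finset.sum_range_succ _ (N + 1)]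
      linarith [pm_l2_nonneg ((Yop ζ j)^[N + 1] h)]
    calc |ζ j| ^ (N + 1) * ‖∫ v, h v * G v‖
        = |ζ j| ^ N * (|ζ j| * ‖∫ v, h v * G v‖) := by ring
      _ ≤ |ζ j| ^ N * (‖∫ v, pmY ζ j h v * G v‖ +
          ‖∫ v, h v * (∂_{(EuclideanSpace.single j (1:ℝ) : E3)} G) v‖) := by
          rw [e3]
          gcongr
          exact norm_add_le _ _
      _ ≤ C1 * _ + C2 * _ := by rw [mul_add]; exact add_le_add e1 e2
      _ ≤ C1 * _ + C2 * _ := add_le_add (mul_le_mul_of_nonneg_left s1 hC1)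
          (mul_le_mul_of_nonneg_left s2 hC2)
      _ = _ := by ring

theorem pm_Yiter_single (ζ : E3) (j : Fin 3) (k : ℕ) (g : E3 → ℂ) :
    Yiter ζ (Pi.single j k) g = (Yop ζ j)^[k] g := by
  fin_cases j <;> simp [Yiter]

theorem pm_sum_le (N : ℕ) (ζ : E3) (j : Fin 3) (g : E3 → ℂ) :
    ∑ k ∈ Finset.range (N + 1), l2norm ((Yop ζ j)^[k] g) ≤
      ∑ ω ∈ multiIdx N, l2norm (Yiter ζ ω g) := by
  simp only [← pm_Yiter_single]
  rw [← Finset.sum_image (s := Finset.range (N + 1)) (g := fun k : ℕ => (Pi.single j k : Fin 3 → ℕ))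
    (f := fun ω => l2norm (Yiter ζ ω g)) (fun a _ b _ hab => Pi.single_injective j hab)]
  refine Finset.sum_le_sum_of_subset_of_nonneg ?_ (fun _ _ _ => pm_l2_nonneg _)
  intro ω hω
  obtain ⟨k, hk, rfl⟩ := Finset.mem_image.1 hω
  have hk' : k < N + 1 := Finset.mem_range.1 hk
  simp only [multiIdx, Finset.mem_filter, Fintype.mem_piFinset, Finset.mem_range]
  refine ⟨fun i => ?_, ?_⟩
  · rw [Pi.single_apply]; split_ifs <;> omega
  · rw [Finset.sum_pi_single']; simp; omega

theorem pm_exists_coord (ζ : E3) : ∃ j, ‖ζ‖ ≤ 3 * |ζ j| := by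
  obtain ⟨j, -, hj⟩ := Finset.exists_max_image Finset.univ (fun j => |ζ j|) ⟨0, Finset.mem_univ _⟩
  refine ⟨j, ?_⟩
  rw [EuclideanSpace.norm_eq]
  apply Real.sqrt_le_iff.2 ⟨by positivity, ?_⟩
  calc ∑ i, ‖ζ i‖ ^ 2 ≤ ∑ i : Fin 3, |ζ j| ^ 2 :=
        Finset.sum_le_sum fun i hi => by
          rw [Real.norm_eq_abs]; exact pow_le_pow_left₀ (abs_nonneg _) (hj i hi) 2
    _ ≤ (3 * |ζ j|) ^ 2 := by simp; nlinarith [sq_nonneg (ζ j), sq_abs (ζ j)]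

/-- **Phase-mixing bound for Gaussian moments.**  For every `N ∈ ℕ` there is `C_N > 0`
such that for every Schwartz function `h : ℝ³ → ℂ` and every `ζ ∈ ℝ³`,
`(1 + |ζ|^N) |∫ h(v) μ(v)^{1/2} dv| ≤ C_N Σ_{|ω| ≤ N} ‖(∇_v + iζ)^ω h‖_{L²}`. -/
theorem phase_mixing_gaussian_moment (N : ℕ) :
    ∃ C > 0, ∀ (h : SchwartzMap E3 ℂ) (ζ : E3),
      (1 + ‖ζ‖ ^ N) * ‖∫ v : E3, h v * ((Real.sqrt (maxwellian v) : ℝ) : ℂ)‖ ≤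
        C * ∑ ω ∈ multiIdx N, l2norm (Yiter ζ ω (h : E3 → ℂ)) := by
  choose C hC hb using fun j => pm_main j N pmGauss
  refine ⟨l2norm pmGauss + 3 ^ N * ∑ j, C j + 1, ?_, fun h ζ => ?_⟩
  · have := pm_l2_nonneg pmGauss
    have := Finset.sum_nonneg (s := Finset.univ) (fun j _ => hC j)
    positivity
  simp only [← pmGauss_apply]
  set S := ∑ ω ∈ multiIdx N, l2norm (Yiter ζ ω (h : E3 → ℂ)) with hS
  set A := ‖∫ v : E3, h v * pmGauss v‖ with hA
  have hS0 : 0 ≤ S := Finset.sum_nonneg fun _ _ => pm_l2_nonneg _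
  obtain ⟨j, hj⟩ := pm_exists_coord ζ
  have h1 : A ≤ l2norm pmGauss * S := by
    refine (pm_cs h pmGauss).trans (mul_le_mul_of_nonneg_left ?_ (pm_l2_nonneg _))
    refine le_trans ?_ (pm_sum_le N ζ j h)
    exact Finset.single_le_sum (f := fun k => l2norm ((Yop ζ j)^[k] h))
      (fun _ _ => pm_l2_nonneg _) (Finset.mem_range.2 (Nat.succ_pos N))
  have h2 : ‖ζ‖ ^ N * A ≤ 3 ^ N * ((∑ j, C j) * S) := by
    calc ‖ζ‖ ^ N * A ≤ (3 * |ζ j|) ^ N * A := by gcongr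
      _ = 3 ^ N * (|ζ j| ^ N * A) := by ring
      _ ≤ 3 ^ N * (C j * S) := by
          refine mul_le_mul_of_nonneg_left ?_ (by positivity)
          exact (hb j h ζ).trans (mul_le_mul_of_nonneg_left (pm_sum_le N ζ j h) (hC j))
      _ ≤ _ := by
          gcongr
          exact Finset.single_le_sum (fun j _ => hC j) (Finset.mem_univ j)
  nlinarith
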